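/- Let N > 1 be an odd integer and b, c real constants with c ≠ 0, and let g : ℕ × ℝ → ℝ be continuous in its second variable and N-periodic in its first variable. Suppose there exist constants s ≥ 1, M₁, M₂ ≥ 0, and ẑ > 0 such that: (i) |g(t,x)| ≤ M₁|x|^s + M₂ for all t ∈ ℕ and x ∈ ℝ; (ii) x·g(t,x) > 0 for all t ∈ ℕ and all x with |x| > ẑ; (iii) ẑ + ‖M_p ∘ (I − Q)‖·(M₁·4^s·ẑ^s + M₂) < 2ẑ; (iv) if N·arccos(−b/2) is an integer multiple of 2π, then c ≠ 1 or |b| ≥ 2. Then there exists an N-periodic function y : ℕ → ℝ satisfying y(t+2) + b·y(t+1) + c·y(t) = g(t, y(t)) for all t ∈ ℕ. -/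

import Mathlib

open Matrix

/-- The Euclidean norm of a vector in `ℝ²`. -/
noncomputable def euclNorm2 (v : Fin 2 → ℝ) : ℝ := Real.sqrt (v 0 ^ 2 + v 1 ^ 2)

/-- The supremum norm on functions `ℕ → ℝ²` (with the Euclidean norm on `ℝ²`). -/
noncomputable def supNorm (x : ℕ → Fin 2 → ℝ) : ℝ := ⨆ t : ℕ, euclNorm2 (x t)


section Brouwer

open Set Metric MeasureTheory

/-- On a finite-dimensional space, `det (id + f)` is an affine combination, with coefficients
independent of `f`, of the values `det (id + t • f)` at small positive parameters `t`. -/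
theorem exists_det_id_add_eq_sum (E : Type*) [NormedAddCommGroup E] [NormedSpace ℝ E]
    [FiniteDimensional ℝ E] {δ : ℝ} (hδ : 0 < δ) :
    ∃ (s : Finset ℕ) (τ a : ℕ → ℝ), (∀ j ∈ s, 0 < τ j ∧ τ j < δ) ∧ ∑ j ∈ s, a j = 1 ∧
      ∀ f : E →L[ℝ] E, (ContinuousLinearMap.id ℝ E + f).det =
        ∑ j ∈ s, a j * (ContinuousLinearMap.id ℝ E + τ j • f).det := by
  classical
  set n := Module.finrank ℝ E
  let τ : ℕ → ℝ := fun j => δ / (j + 2)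
  have hτ : Function.Injective τ := by
    intro i j hij
    have hi : (i : ℝ) + 2 ≠ 0 := by positivity
    have hj : (j : ℝ) + 2 ≠ 0 := by positivity
    simp only [τ] at hij
    rw [div_eq_div_iff hi hj] at hij
    have := mul_left_cancel₀ hδ.ne' hij
    exact_mod_cast (by linarith : (i : ℝ) = j)
  let s := Finset.range (n + 1)
  refine ⟨s, τ, fun j => (Lagrange.basis s τ j).eval 1, ?_, ?_, ?_⟩
  · intro j _
    refine ⟨by positivity, ?_⟩
    rw [div_lt_iff₀ (by positivity)]
    nlinarith [(Nat.cast_nonneg j : (0 : ℝ) ≤ j)]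
  · rw [← Polynomial.eval_finsetSum, Lagrange.sum_basis hτ.injOn (by simp [s])]
    simp
  · intro f
    let b := Module.finBasis ℝ E
    let M := LinearMap.toMatrix b b f
    let p : Polynomial ℝ := det ((Polynomial.X : Polynomial ℝ) • M.map Polynomial.C +
      (1 : Matrix _ _ ℝ).map Polynomial.C)
    have hp : ∀ t : ℝ, (ContinuousLinearMap.id ℝ E + t • f).det = p.eval t := by
      intro t
      have h1 : (ContinuousLinearMap.id ℝ E + t • f).det = Matrix.det (1 + t • M) := by
        change LinearMap.det _ = _
        rw [← LinearMap.det_toMatrix b]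
        congr 1
        simp [M]
      rw [h1]
      simp only [p]
      rw [← Polynomial.coe_evalRingHom, RingHom.map_det]
      congr 1
      ext i j
      simp only [RingHom.mapMatrix_apply, Matrix.map_apply, Matrix.add_apply, Matrix.smul_apply,
        smul_eq_mul, Polynomial.coe_evalRingHom, Polynomial.eval_add, Polynomial.eval_mul,
        Polynomial.eval_X, Polynomial.eval_C]
      ring
    have hdeg : p.degree < (s.card : ℕ) := by
      refine lt_of_le_of_lt Polynomial.degree_le_natDegree ?_
      have := Polynomial.natDegree_det_X_add_C_le M 1
      simp only [Fintype.card_fin] at this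
      simp only [s, Finset.card_range]
      exact_mod_cast Nat.lt_succ_of_le this
    have h := congrArg (Polynomial.eval 1) (Lagrange.eq_interpolate hτ.injOn hdeg)
    rw [← hp, one_smul, Lagrange.interpolate_apply, Polynomial.eval_finsetSum] at h
    rw [h]
    refine Finset.sum_congr rfl fun j _ => ?_
    rw [hp]
    simp [mul_comm]

/-- If `f` has norm at most `K`, then `id + t • f` has positive determinant for `t * K < 1`. -/
theorem det_id_add_smul_pos {E : Type*} [NormedAddCommGroup E] [NormedSpace ℝ E]
    [FiniteDimensional ℝ E] {f : E →L[ℝ] E} {K t : ℝ} (hf : ‖f‖ ≤ K) (ht : 0 ≤ t)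
    (htK : t * K < 1) : 0 < (ContinuousLinearMap.id ℝ E + t • f).det := by
  have hne : ∀ u ∈ Icc 0 t, (ContinuousLinearMap.id ℝ E + u • f).det ≠ 0 := by
    intro u hu h0
    have hK : 0 ≤ K := (norm_nonneg f).trans hf
    obtain ⟨v, hv, hv0⟩ :=
      (Submodule.ne_bot_iff _).1 (LinearMap.bot_lt_ker_of_det_eq_zero h0).ne'
    have hv' : v + u • f v = 0 := by simpa [LinearMap.mem_ker] using hv
    have h1 : ‖v‖ = u * ‖f v‖ := by
      rw [← Real.norm_of_nonneg hu.1, ← norm_smul, ← norm_neg (u • f v)]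
      exact congrArg norm (eq_neg_of_add_eq_zero_left hv')
    have h2 := f.le_of_opNorm_le hf v
    have h3 : 0 < ‖v‖ := norm_pos_iff.2 hv0
    have h4 : u * ‖f v‖ ≤ t * (K * ‖v‖) := mul_le_mul hu.2 h2 (norm_nonneg _) ht
    nlinarith
  by_contra hle
  push Not at hle
  have hcont : ContinuousOn (fun u : ℝ => (ContinuousLinearMap.id ℝ E + u • f).det)
      (Icc 0 t) := by
    have : Continuous fun u : ℝ => (ContinuousLinearMap.id ℝ E + u • f) := by fun_prop
    exact (ContinuousLinearMap.continuous_det.comp this).continuousOn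
  have h0 : (ContinuousLinearMap.id ℝ E + (0 : ℝ) • f).det = 1 := by
    simp [ContinuousLinearMap.det]
  obtain ⟨u, hu, hu0⟩ := intermediate_value_Icc' ht hcont ⟨hle, h0 ▸ zero_le_one⟩
  exact hne u hu hu0

/-- A Lipschitz perturbation of the identity with small constant is bijective. -/
theorem bijective_id_add_of_lipschitzWith {E : Type*} [NormedAddCommGroup E] [NormedSpace ℝ E]
    [CompleteSpace E] {h : E → E} {K : NNReal} (hh : LipschitzWith K h) (hK : K < 1) :
    Function.Bijective fun x => x + h x := by
  have hA : ApproximatesLinearOn (fun x => x + h x)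
      ((ContinuousLinearEquiv.refl ℝ E : E ≃L[ℝ] E) : E →L[ℝ] E) univ K := by
    rw [ApproximatesLinearOn.approximatesLinearOn_iff_lipschitzOnWith, lipschitzOnWith_univ]
    convert hh using 1
    ext x
    simp
  have hc : Subsingleton E ∨
      K < ‖((ContinuousLinearEquiv.refl ℝ E).symm : E →L[ℝ] E)‖₊⁻¹ := by
    rcases subsingleton_or_nontrivial E with hE | hE
    · exact Or.inl hE
    · right
      have : ‖((ContinuousLinearEquiv.refl ℝ E).symm : E →L[ℝ] E)‖₊ = 1 := by
        change ‖ContinuousLinearMap.id ℝ E‖₊ = 1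
        simp
      simpa [this] using hK
  refine ⟨?_, hA.surjective hc⟩
  have := hA.injOn hc
  rwa [injOn_univ] at this

/-- A map which is Lipschitz on the closed unit ball and vanishes outside the open unit ball is
Lipschitz. -/
theorem lipschitzWith_of_lipschitzOnWith_closedBall {E F : Type*} [NormedAddCommGroup E]
    [NormedSpace ℝ E] [NormedAddCommGroup F] {h : E → F} {K : NNReal}
    (hh : LipschitzOnWith K h (closedBall 0 1)) (h0 : ∀ x, 1 ≤ ‖x‖ → h x = 0) :
    LipschitzWith K h := by
  have key : ∀ x y : E, ‖x‖ ≤ 1 → 1 < ‖y‖ → dist (h x) (h y) ≤ K * dist x y := by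
    intro x y hx hy
    have hcont : ContinuousOn (fun t : ℝ => ‖x + t • (y - x)‖) (Icc 0 1) := by fun_prop
    obtain ⟨t, ht, hxt⟩ := intermediate_value_Icc zero_le_one hcont
      (show (1 : ℝ) ∈ _ by constructor <;> simp [hx, hy.le])
    simp only at hxt
    have hp := hh.dist_le_mul x (by simpa using hx) (x + t • (y - x)) (by simp [hxt])
    rw [h0 _ hxt.ge] at hp
    rw [h0 y hy.le]
    refine hp.trans ?_
    gcongr
    rw [dist_self_add_right, norm_smul, Real.norm_of_nonneg ht.1, dist_comm, dist_eq_norm]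
    exact mul_le_of_le_one_left (norm_nonneg _) ht.2
  refine LipschitzWith.of_dist_le_mul fun x y => ?_
  rcases le_or_gt ‖x‖ 1 with hx | hx <;> rcases le_or_gt ‖y‖ 1 with hy | hy
  · exact hh.dist_le_mul x (by simpa using hx) y (by simpa using hy)
  · exact key x y hx hy
  · rw [dist_comm, dist_comm x y]
    exact key y x hy hx
  · rw [h0 x hx.le, h0 y hy.le, dist_self]
    positivity

/-- There is no continuously differentiable retraction of the closed unit ball onto its
boundary. -/
theorem not_exists_contDiffAt_retraction {E : Type*} [NormedAddCommGroup E]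
    [InnerProductSpace ℝ E] [FiniteDimensional ℝ E] {r : E → E}
    (hr : ∀ x, ‖x‖ ≤ 1 → ContDiffAt ℝ 1 r x) (hr1 : ∀ x, ‖x‖ ≤ 1 → ‖r x‖ = 1)
    (hr2 : ∀ x, ‖x‖ = 1 → r x = x) : False := by
  classical
  borelize E
  let μ : Measure E := Measure.addHaar
  let g₀ : E → E := fun x => r x - x
  have hg₀ : ∀ x, ‖x‖ ≤ 1 → ContDiffAt ℝ 1 g₀ x := fun x hx => (hr x hx).sub contDiffAt_id
  have hcont : ContinuousOn (fderiv ℝ g₀) (closedBall 0 1) := fun x hx =>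
    ((hg₀ x (by simpa using hx)).fderiv_right (m := 0) (by simp)).continuousAt.continuousWithinAt
  obtain ⟨K₀, hK₀⟩ := (isCompact_closedBall (0 : E) 1).exists_bound_of_continuousOn hcont
  let K : NNReal := K₀.toNNReal
  have hK : ∀ x ∈ closedBall (0 : E) 1, ‖fderiv ℝ g₀ x‖ ≤ K := fun x hx =>
    (hK₀ x hx).trans (Real.le_coe_toNNReal K₀)
  have hLip₀ : LipschitzOnWith K g₀ (closedBall 0 1) :=
    (convex_closedBall (0 : E) 1).lipschitzOnWith_of_nnnorm_fderiv_le
      (fun x hx => (hg₀ x (by simpa using hx)).differentiableAt (by simp)) hK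
  let g : E → E := fun x => if ‖x‖ ≤ 1 then g₀ x else 0
  have hgeq : ∀ x, ‖x‖ ≤ 1 → g x = g₀ x := fun x hx => if_pos hx
  have hg0 : ∀ x, 1 ≤ ‖x‖ → g x = 0 := by
    intro x hx
    rcases hx.eq_or_lt with hx | hx
    · rw [hgeq x hx.ge]
      simp [g₀, hr2 x hx.symm]
    · exact if_neg (not_le.2 hx)
  have hLip : LipschitzWith K g := by
    refine lipschitzWith_of_lipschitzOnWith_closedBall (fun x hx y hy => ?_) hg0
    rw [hgeq x (by simpa using hx), hgeq y (by simpa using hy)]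
    exact hLip₀ hx hy
  let δ : ℝ := 1 / (K + 1)
  have hδ : 0 < δ := by positivity
  have h_integrable : ∀ t : ℝ, IntegrableOn
      (fun x => (ContinuousLinearMap.id ℝ E + t • fderiv ℝ g₀ x).det) (ball 0 1) μ := by
    intro t
    refine IntegrableOn.mono_set ?_ ball_subset_closedBall
    refine ContinuousOn.integrableOn_compact (isCompact_closedBall (0 : E) 1) ?_
    exact ContinuousLinearMap.continuous_det.comp_continuousOn
      (continuousOn_const.add (hcont.const_smul t))
  have hvol : ∀ t : ℝ, 0 < t → t < δ →
      ∫ x in ball 0 1, (ContinuousLinearMap.id ℝ E + t • fderiv ℝ g₀ x).det ∂μ =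
        μ.real (ball 0 1) := by
    intro t ht0 htδ
    have htK : t * K < 1 := by
      have : t * (K + 1) < 1 := by rwa [lt_div_iff₀ (by positivity)] at htδ
      nlinarith
    have hbij : Function.Bijective fun x => x + t • g x := by
      have hl : LipschitzWith (t.toNNReal * K) fun x => t • g x := by
        refine LipschitzWith.of_dist_le_mul fun x y => ?_
        rw [dist_smul₀, Real.norm_of_nonneg ht0.le, NNReal.coe_mul, Real.coe_toNNReal t ht0.le,
          mul_assoc]
        gcongr
        exact hLip.dist_le_mul x y
      refine bijective_id_add_of_lipschitzWith hl ?_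
      rw [← NNReal.coe_lt_coe, NNReal.coe_mul, Real.coe_toNNReal t ht0.le]
      simpa using htK
    have hout : ∀ x, 1 ≤ ‖x‖ → x + t • g x = x := fun x hx => by simp [hg0 x hx]
    have himage : (fun x => x + t • g x) '' ball 0 1 = ball 0 1 := by
      ext y
      simp only [mem_image, mem_ball_zero_iff]
      constructor
      · rintro ⟨x, hx, rfl⟩
        by_contra hy
        push Not at hy
        have : x + t • g x = x := hbij.1 (hout _ hy)
        rw [this] at hy
        exact absurd hx (not_lt.2 hy)
      · intro hy
        obtain ⟨x, rfl⟩ := hbij.2 y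
        refine ⟨x, ?_, rfl⟩
        by_contra hx
        push Not at hx
        simp only [hout x hx] at hy
        exact absurd hy (not_lt.2 hx)
    have hderiv : ∀ x ∈ ball (0 : E) 1, HasFDerivWithinAt (fun x => x + t • g x)
        (ContinuousLinearMap.id ℝ E + t • fderiv ℝ g₀ x) (ball 0 1) x := by
      intro x hx
      have hx' : ‖x‖ ≤ 1 := (mem_ball_zero_iff.1 hx).le
      have h1 : HasFDerivWithinAt (fun x => x + t • g₀ x)
          (ContinuousLinearMap.id ℝ E + t • fderiv ℝ g₀ x) (ball 0 1) x :=
        ((hasFDerivAt_id x).add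
          (((hg₀ x hx').differentiableAt (by simp)).hasFDerivAt.const_smul t)).hasFDerivWithinAt
      refine h1.congr (fun y hy => ?_) ?_
      · rw [hgeq y (mem_ball_zero_iff.1 hy).le]
      · rw [hgeq x hx']
    have h := integral_image_eq_integral_abs_det_fderiv_smul μ measurableSet_ball hderiv
      hbij.1.injOn (fun _ => (1 : ℝ))
    rw [himage] at h
    simp only [smul_eq_mul, mul_one, integral_const, MeasurableSet.univ,
      measureReal_restrict_apply, univ_inter] at h
    rw [h]
    refine setIntegral_congr_fun measurableSet_ball fun x hx => ?_
    exact (abs_of_pos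
      (det_id_add_smul_pos (hK x (ball_subset_closedBall hx)) ht0.le htK)).symm
  obtain ⟨s, τ, a, hτ, ha, hdet⟩ := exists_det_id_add_eq_sum E hδ
  have hzero : ∀ x ∈ ball (0 : E) 1, (ContinuousLinearMap.id ℝ E + fderiv ℝ g₀ x).det = 0 := by
    intro x hx
    have hx' : ‖x‖ ≤ 1 := (mem_ball_zero_iff.1 hx).le
    have hrd := ((hr x hx').differentiableAt (by simp)).hasFDerivAt
    have hder : ContinuousLinearMap.id ℝ E + fderiv ℝ g₀ x = fderiv ℝ r x := by
      have : HasFDerivAt g₀ (fderiv ℝ r x - ContinuousLinearMap.id ℝ E) x :=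
        hrd.sub (hasFDerivAt_id x)
      rw [this.fderiv]
      abel
    rw [hder]
    by_contra hne
    have hsurj : Function.Surjective (fderiv ℝ r x) := by
      have h1 : IsUnit (LinearMap.det (fderiv ℝ r x : E →ₗ[ℝ] E)) := isUnit_iff_ne_zero.2 hne
      have h2 := (LinearMap.isUnit_iff_isUnit_det (fderiv ℝ r x : E →ₗ[ℝ] E)).2 h1
      exact ((Module.End.isUnit_iff _).1 h2).2
    obtain ⟨v, hv⟩ := hsurj (r x)
    have hsq : HasFDerivAt (fun y => ‖r y‖ ^ 2) (2 • (innerSL ℝ (r x)).comp (fderiv ℝ r x)) x :=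
      hrd.norm_sq
    have hconst : HasFDerivAt (fun y => ‖r y‖ ^ 2) (0 : E →L[ℝ] ℝ) x := by
      refine (hasFDerivAt_const (1 : ℝ) x).congr_of_eventuallyEq ?_
      filter_upwards [isOpen_ball.mem_nhds hx] with y hy
      simp [hr1 y (mem_ball_zero_iff.1 hy).le]
    have h := congrArg (fun φ : E →L[ℝ] ℝ => φ v) (hsq.unique hconst)
    simp [hv, hr1 x hx'] at h
  have h1 : ∫ x in ball 0 1, (ContinuousLinearMap.id ℝ E + fderiv ℝ g₀ x).det ∂μ = 0 :=
    setIntegral_eq_zero_of_forall_eq_zero hzero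
  rw [setIntegral_congr_fun measurableSet_ball fun x _ => hdet (fderiv ℝ g₀ x),
    integral_finsetSum _ fun j _ => (h_integrable (τ j)).const_mul (a j)] at h1
  simp only [integral_const_mul] at h1
  rw [Finset.sum_congr rfl fun j hj => by rw [hvol (τ j) (hτ j hj).1 (hτ j hj).2],
    ← Finset.sum_mul, ha, one_mul] at h1
  have : 0 < μ.real (ball (0 : E) 1) :=
    ENNReal.toReal_pos (measure_ball_pos μ 0 one_pos).ne' measure_ball_lt_top.ne
  exact this.ne' h1


open scoped RealInnerProductSpace

/-- A continuously differentiable map of the closed unit ball into the open unit ball has a fixed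
point. -/
theorem exists_fixedPoint_of_contDiff {E : Type*} [NormedAddCommGroup E]
    [InnerProductSpace ℝ E] [FiniteDimensional ℝ E] {p : E → E} (hp : ContDiff ℝ 1 p)
    (hp1 : ∀ x, ‖x‖ ≤ 1 → ‖p x‖ < 1) : ∃ x, ‖x‖ ≤ 1 ∧ p x = x := by
  by_contra! hne
  let u : E → E := fun x => x - p x
  have hu : ContDiff ℝ 1 u := contDiff_id.sub hp
  have hu0 : ∀ x, ‖x‖ ≤ 1 → 0 < ‖u x‖ ^ 2 := fun x hx => by
    have : u x ≠ 0 := sub_ne_zero.2 (hne x hx).symm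
    positivity
  have hinner : ∀ x, ‖x‖ = 1 → 0 < ⟪x, u x⟫ := by
    intro x hx
    have h1 := real_inner_le_norm x (p x)
    have h2 := hp1 x hx.le
    simp only [u, inner_sub_right, real_inner_self_eq_norm_sq, hx] at *
    linarith
  let D : E → ℝ := fun x => ⟪x, u x⟫ ^ 2 + ‖u x‖ ^ 2 * (1 - ‖x‖ ^ 2)
  have hD : ∀ x, ‖x‖ ≤ 1 → 0 < D x := by
    intro x hx
    rcases hx.eq_or_lt with hx' | hx'
    · have := hinner x hx'
      simp only [D, hx']
      nlinarith
    · have h1 : 0 < 1 - ‖x‖ ^ 2 := by nlinarith [norm_nonneg x]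
      have := mul_pos (hu0 x hx) h1
      simp only [D]
      positivity
  let l : E → ℝ := fun x => (√(D x) - ⟪x, u x⟫) / ‖u x‖ ^ 2
  refine not_exists_contDiffAt_retraction (r := fun x => x + l x • u x) ?_ ?_ ?_
  · intro x hx
    have hi : ContDiff ℝ 1 fun x => ⟪x, u x⟫ := contDiff_id.inner ℝ hu
    have hn : ContDiff ℝ 1 fun x => ‖u x‖ ^ 2 := hu.norm_sq ℝ
    have hDc : ContDiff ℝ 1 D :=
      (hi.pow 2).add (hn.mul (contDiff_const.sub (contDiff_id.norm_sq ℝ)))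
    have hl : ContDiffAt ℝ 1 l x :=
      ((hDc.contDiffAt.sqrt (hD x hx).ne').sub hi.contDiffAt).div hn.contDiffAt (hu0 x hx).ne'
    exact contDiffAt_id.add (hl.smul hu.contDiffAt)
  · intro x hx
    have hsq : ‖x + l x • u x‖ ^ 2 = 1 := by
      rw [norm_add_sq_real, inner_smul_right, norm_smul, mul_pow, Real.norm_eq_abs, sq_abs]
      have h1 : l x * ‖u x‖ ^ 2 = √(D x) - ⟪x, u x⟫ := div_mul_cancel₀ _ (hu0 x hx).ne'
      have h2 : √(D x) ^ 2 = ⟪x, u x⟫ ^ 2 + ‖u x‖ ^ 2 * (1 - ‖x‖ ^ 2) := Real.sq_sqrt (hD x hx).le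
      refine mul_left_cancel₀ (hu0 x hx).ne' ?_
      have h3 : (l x * ‖u x‖ ^ 2 + ⟪x, u x⟫) ^ 2 = √(D x) ^ 2 := by rw [h1]; ring
      rw [h2] at h3
      linear_combination h3
    exact (sq_eq_sq₀ (norm_nonneg _) zero_le_one).1 (by simpa using hsq)
  · intro x hx
    have : l x = 0 := by simp [l, D, hx, Real.sqrt_sq (hinner x hx).le]
    simp [this]

/-- **Brouwer's fixed point theorem** for a continuous map of a finite-dimensional inner product
space whose range lies in a ball of radius less than one. -/
theorem exists_fixedPoint_of_norm_le_of_lt_one {E : Type*} [NormedAddCommGroup E]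
    [InnerProductSpace ℝ E] [FiniteDimensional ℝ E] {F : E → E} (hF : Continuous F) {ρ : ℝ}
    (hρ : ρ < 1) (hFρ : ∀ x, ‖F x‖ ≤ ρ) : ∃ x, F x = x := by
  by_contra! hne
  obtain ⟨x₀, -, hmin⟩ := (isCompact_closedBall (0 : E) 1).exists_isMinOn ⟨0, by simp⟩
    (hF.sub continuous_id).norm.continuousOn
  let ε := min ‖F x₀ - x₀‖ (1 - ρ)
  have hε : 0 < ε := lt_min (norm_pos_iff.2 (sub_ne_zero.2 (hne x₀))) (by linarith)
  obtain ⟨p, hp, hpF, -⟩ := hF.exists_contDiff_approx 1 (continuous_const (y := ε)) fun _ => hε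
  obtain ⟨x, hx, hfix⟩ := exists_fixedPoint_of_contDiff hp fun x _ => by
    have h1 := hpF x
    have h2 := hFρ x
    have h3 : ε ≤ 1 - ρ := min_le_right _ _
    rw [dist_eq_norm] at h1
    have h4 := norm_add_le (p x - F x) (F x)
    rw [sub_add_cancel] at h4
    linarith
  have h1 : ‖F x₀ - x₀‖ ≤ ‖F x - x‖ := hmin (show x ∈ closedBall (0 : E) 1 by simpa using hx)
  have h2 := hpF x
  rw [hfix, dist_comm, dist_eq_norm] at h2
  exact absurd (h2.trans_le (min_le_left _ _)) (not_lt.2 h1)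

/-- **Brouwer's fixed point theorem**: a continuous self-map of a finite-dimensional space with
bounded range has a fixed point. -/
theorem exists_fixedPoint_of_isBounded_range {E : Type*} [NormedAddCommGroup E]
    [NormedSpace ℝ E] [FiniteDimensional ℝ E] {F : E → E} (hF : Continuous F)
    (hb : Bornology.IsBounded (range F)) : ∃ x, F x = x := by
  let e : E ≃L[ℝ] EuclideanSpace ℝ (Fin (Module.finrank ℝ E)) := toEuclidean
  obtain ⟨R, hR⟩ := hb.exists_norm_le
  have hR0 : 0 ≤ R := (norm_nonneg _).trans (hR _ ⟨0, rfl⟩)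
  let k : ℝ := ‖(e : E →L[ℝ] EuclideanSpace ℝ (Fin (Module.finrank ℝ E)))‖ * R + 1
  have hk : 0 < k := by positivity
  obtain ⟨x, hx⟩ := exists_fixedPoint_of_norm_le_of_lt_one
    (F := fun x => k⁻¹ • e (F (e.symm (k • x)))) (ρ := k⁻¹ * (k - 1)) (by fun_prop)
    (by rw [inv_mul_lt_iff₀ hk]; linarith) fun x => by
      rw [norm_smul, Real.norm_of_nonneg (by positivity)]
      gcongr
      simp only [k, add_sub_cancel_right]
      exact (e : E →L[ℝ] EuclideanSpace ℝ (Fin (Module.finrank ℝ E))).le_opNorm_of_le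
        (hR _ ⟨_, rfl⟩)
  refine ⟨e.symm (k • x), e.injective ?_⟩
  rw [e.apply_symm_apply]
  nth_rewrite 2 [← hx]
  rw [smul_inv_smul₀ hk.ne']

end Brouwer

section CompanionMatrix

/-- A root of `X ^ 2 + b X + c` which is a nontrivial root of unity of odd order `N` is excluded by
the nonresonance condition. -/
theorem geom_sum_ne_zero_of_root {N : ℕ} (hNodd : Odd N) {b c : ℝ}
    (hres : (∃ k : ℤ, (N : ℝ) * Real.arccos (-b / 2) = 2 * Real.pi * k) → (c ≠ 1 ∨ 2 ≤ |b|))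
    {l : ℂ} (hl : l ^ 2 + b * l + c = 0) : ∑ i ∈ Finset.range N, l ^ i ≠ 0 := by
  intro hsum
  have hN0 : N ≠ 0 := hNodd.pos.ne'
  have hlN : l ^ N = 1 := by
    have := mul_neg_geom_sum l N
    rw [hsum, mul_zero] at this
    linear_combination this
  have hnorm : l.re ^ 2 + l.im ^ 2 = 1 := by
    have h := Complex.sq_norm l
    rw [Complex.norm_eq_one_of_pow_eq_one hlN hN0, Complex.normSq_apply] at h
    linarith
  have him : l.im ≠ 0 := by
    intro h0
    have hlre : l = (l.re : ℂ) := Complex.ext (by simp) (by simp [h0])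
    rw [h0] at hnorm
    have h1 : (l.re - 1) * (l.re + 1) = 0 := by linarith
    rcases mul_eq_zero.1 h1 with h1 | h1
    · rw [hlre, show l.re = 1 by linarith] at hsum
      simp [hN0] at hsum
    · rw [hlre, show l.re = -1 by linarith] at hlN
      have : (-1 : ℂ) ^ N = -1 := hNodd.neg_one_pow
      push_cast at hlN
      rw [this] at hlN
      norm_num at hlN
  have hre := congrArg Complex.re hl
  have him' := congrArg Complex.im hl
  simp only [pow_two, Complex.add_re, Complex.mul_re, Complex.ofReal_re, Complex.ofReal_im,
    Complex.zero_re, Complex.add_im, Complex.mul_im, Complex.zero_im] at hre him'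
  have hb : -b / 2 = l.re := by
    have : l.im * (2 * l.re + b) = 0 := by linarith
    have := (mul_eq_zero.1 this).resolve_left him
    linarith
  have hc1 : c = 1 := by
    rw [show b = -2 * l.re by linarith] at hre
    nlinarith
  have himsq : 0 < l.im ^ 2 := by positivity
  have hre_lt : l.re ^ 2 < 1 := by linarith
  have hre_abs := (sq_lt_one_iff_abs_lt_one _).1 hre_lt
  have hcos : Real.cos (Real.arccos l.re) = l.re :=
    Real.cos_arccos (by linarith [(abs_lt.1 hre_abs).1]) (by linarith [(abs_lt.1 hre_abs).2])
  have hk : ∃ k : ℤ, (N : ℝ) * Real.arccos (-b / 2) = 2 * Real.pi * k := by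
    rw [hb]
    have key : ∀ θ : ℝ, l = Complex.exp (θ * Complex.I) →
        Real.cos (N * θ) = 1 := by
      intro θ hθ
      rw [hθ, ← Complex.exp_nat_mul] at hlN
      have := congrArg Complex.re hlN
      rw [← mul_assoc, show ((N : ℂ) * (θ : ℂ)) = ((N * θ : ℝ) : ℂ) by push_cast; rfl,
        Complex.exp_ofReal_mul_I_re] at this
      simpa using this
    have hsin : Real.sin (Real.arccos l.re) ^ 2 = l.im ^ 2 := by
      rw [Real.sin_sq, hcos]
      linarith
    have hone : Real.cos (N * Real.arccos l.re) = 1 := by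
      rcases sq_eq_sq_iff_eq_or_eq_neg.1 hsin with h | h
      · refine key _ (Complex.ext ?_ ?_)
        · rw [Complex.exp_ofReal_mul_I_re, hcos]
        · rw [Complex.exp_ofReal_mul_I_im, h]
      · rw [← Real.cos_neg, ← mul_neg]
        refine key _ (Complex.ext ?_ ?_)
        · rw [Complex.exp_ofReal_mul_I_re, Real.cos_neg, hcos]
        · rw [Complex.exp_ofReal_mul_I_im, Real.sin_neg, h, neg_neg]
    obtain ⟨k, hk⟩ := (Real.cos_eq_one_iff _).1 hone
    exact ⟨k, by rw [← hk]; ring⟩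
  rcases hres hk with h | h
  · exact h hc1
  · rw [show b = -2 * l.re by linarith, abs_mul] at h
    norm_num at h
    linarith

theorem isUnit_geom_sum_companion {N : ℕ} (hNodd : Odd N) {b c : ℝ}
    (hres : (∃ k : ℤ, (N : ℝ) * Real.arccos (-b / 2) = 2 * Real.pi * k) → (c ≠ 1 ∨ 2 ≤ |b|)) :
    IsUnit (∑ i ∈ Finset.range N, (!![0, 1; -c, -b] : Matrix (Fin 2) (Fin 2) ℝ) ^ i) := by
  set A : Matrix (Fin 2) (Fin 2) ℝ := !![0, 1; -c, -b] with hA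
  have hcop : IsCoprime (∑ i ∈ Finset.range N, (Polynomial.X : Polynomial ℝ) ^ i)
      (Polynomial.X ^ 2 + Polynomial.C b * Polynomial.X + Polynomial.C c) := by
    rw [Polynomial.isCoprime_iff_aeval_ne_zero_of_isAlgClosed ℝ ℂ]
    intro l
    by_contra! h
    have h2 : l ^ 2 + b * l + c = 0 := by simpa using h.2
    exact geom_sum_ne_zero_of_root hNodd hres h2 (by simpa using h.1)
  obtain ⟨p, q, hpq⟩ := hcop
  have hchar : A ^ 2 + algebraMap ℝ _ b * A + algebraMap ℝ _ c = 0 := by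
    rw [hA, pow_two]
    ext i j
    fin_cases i <;> fin_cases j <;>
      simp [Matrix.mul_apply, Matrix.algebraMap_matrix_apply]
  have h := congrArg (Polynomial.aeval A) hpq
  simp only [map_add, map_mul, map_sum, map_pow, Polynomial.aeval_X, Polynomial.aeval_C, hchar,
    mul_zero, add_zero, map_one] at h
  exact IsUnit.of_mul_eq_one_right _ h

variable {n : Type*} [Fintype n] [DecidableEq n]

/-- Solvability of the linear periodic problem in terms of the monodromy equation. -/
theorem exists_periodic_linear_solution {N : ℕ} (A : Matrix n n ℝ) {k : ℕ → n → ℝ}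
    (hk : ∀ t, k (t + N) = k t)
    (hsol : ∀ x : ℕ → n → ℝ, x 0 = 0 → (∀ t, x (t + 1) = A *ᵥ x t + k t) →
      ∃ x₀, (1 - A ^ N) *ᵥ x₀ = x N) :
    ∃ x : ℕ → n → ℝ, (∀ t, x (t + N) = x t) ∧ ∀ t, x (t + 1) - A *ᵥ x t = k t := by
  let x : ℕ → n → ℝ := fun t => Nat.rec 0 (fun i v => A *ᵥ v + k i) t
  have hx : ∀ t, x (t + 1) = A *ᵥ x t + k t := fun t => rfl
  obtain ⟨x₀, hx₀⟩ := hsol x rfl hx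
  let y : ℕ → n → ℝ := fun t => x t + A ^ t *ᵥ x₀
  have hy : ∀ t, y (t + 1) = A *ᵥ y t + k t := by
    intro t
    simp only [y, hx, mulVec_add, mulVec_mulVec, pow_succ']
    abel
  refine ⟨y, fun t => ?_, fun t => by rw [hy, add_sub_cancel_left]⟩
  induction t with
  | zero =>
    rw [sub_mulVec, one_mulVec] at hx₀
    simp only [y, zero_add, ← hx₀, pow_zero, one_mulVec, sub_add_cancel]
    simp [x]
  | succ t ih => rw [add_right_comm, hy, hy, ih, hk]

theorem eq_zero_of_periodic_homogeneous_solution {N : ℕ} {A : Matrix n n ℝ} {x : ℕ → n → ℝ}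
    (V : (n → ℝ) → n → ℝ) (hV : ∀ u, (1 - A ^ N) *ᵥ u = 0 → V u = u)
    (hx : ∀ t, x (t + 1) - A *ᵥ x t = 0) (hper : ∀ t, x (t + N) = x t) (h0 : V (x 0) = 0) :
    x = 0 := by
  have hpow : ∀ t, x t = A ^ t *ᵥ x 0 := by
    intro t
    induction t with
    | zero => simp
    | succ t ih => rw [sub_eq_zero.1 (hx t), ih, mulVec_mulVec, pow_succ']
  have hx0 : x 0 = 0 := by
    rw [← hV (x 0), h0]
    rw [sub_mulVec, one_mulVec, ← hpow N, ← hper 0, zero_add, sub_self]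
  ext1 t
  rw [hpow t, hx0, mulVec_zero, Pi.zero_apply]

end CompanionMatrix

section Projection

/-- For a matrix `W` with linearly independent columns and `G = N • WᵀW`, the vectors
`N • W G⁻¹ Wᵀ u` and `u` have the same inner products with the columns of `W`. -/
theorem transpose_mulVec_gram_inv {N m : ℕ} (hN : 0 < N) {W : Matrix (Fin 2) (Fin m) ℝ}
    (hW : LinearIndependent ℝ (fun j : Fin m => Wᵀ j)) {G : Matrix (Fin m) (Fin m) ℝ}
    (hG : G = (N : ℝ) • (Wᵀ * W)) (u : Fin 2 → ℝ) :
    (N : ℝ) • (Wᵀ *ᵥ (W *ᵥ (G⁻¹ *ᵥ (Wᵀ *ᵥ u)))) = Wᵀ *ᵥ u := by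
  have hN0 : (N : ℝ) ≠ 0 := by exact_mod_cast hN.ne'
  have hWinj : Function.Injective W.mulVec := Matrix.mulVec_injective_iff.2 hW
  have hGinj : Function.Injective G.mulVecLin := by
    rw [← LinearMap.ker_eq_bot, LinearMap.ker_eq_bot']
    intro v hv
    rw [hG, Matrix.mulVecLin_apply, smul_mulVec, smul_eq_zero_iff_right hN0] at hv
    have h1 : v ∈ LinearMap.ker (Wᵀ * W).mulVecLin := hv
    rw [Matrix.ker_mulVecLin_transpose_mul_self] at h1
    exact hWinj (by simpa using h1)
  have hunit : IsUnit G.det :=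
    (Matrix.isUnit_iff_isUnit_det G).1 (Matrix.mulVec_injective_iff_isUnit.1 hGinj)
  have h2 : G *ᵥ (G⁻¹ *ᵥ (Wᵀ *ᵥ u)) = Wᵀ *ᵥ u := by
    rw [mulVec_mulVec, Matrix.mul_nonsing_inv G hunit, one_mulVec]
  rw [mulVec_mulVec (M := Wᵀ), ← smul_mulVec, ← hG, h2]

end Projection

section SupNorm

theorem abs_apply_zero_le_euclNorm2 (v : Fin 2 → ℝ) : |v 0| ≤ euclNorm2 v := by
  rw [euclNorm2, ← Real.sqrt_sq_eq_abs]
  exact Real.sqrt_le_sqrt (by nlinarith [sq_nonneg (v 1)])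

theorem euclNorm2_zero_left (a : ℝ) : euclNorm2 ![0, a] = |a| := by
  simp [euclNorm2, Real.sqrt_sq_eq_abs]

theorem supNorm_nonneg (x : ℕ → Fin 2 → ℝ) : 0 ≤ supNorm x :=
  Real.iSup_nonneg fun _ => Real.sqrt_nonneg _

theorem abs_apply_zero_le_supNorm {N : ℕ} (hN : 0 < N) {x : ℕ → Fin 2 → ℝ}
    (hx : ∀ t, x (t + N) = x t) (t : ℕ) : |x t 0| ≤ supNorm x := by
  refine (abs_apply_zero_le_euclNorm2 _).trans (le_ciSup (f := fun t => euclNorm2 (x t)) ?_ t)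
  refine ((Set.finite_range fun i : Fin N => euclNorm2 (x i)).subset ?_).bddAbove
  rintro _ ⟨s, rfl⟩
  exact ⟨⟨s % N, Nat.mod_lt s hN⟩, congrArg euclNorm2 (Function.Periodic.map_mod_nat hx s)⟩

end SupNorm

section Forcing

/-- The `N`-periodic forcing term `t ↦ (0, u (t mod N))` of the first order system. -/
def forcing {N : ℕ} (hN : 0 < N) (u : Fin N → ℝ) : ℕ → Fin 2 → ℝ :=
  fun t => ![0, u ⟨t % N, Nat.mod_lt t hN⟩]

theorem forcing_periodic {N : ℕ} (hN : 0 < N) (u : Fin N → ℝ) (t : ℕ) :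
    forcing hN u (t + N) = forcing hN u t := by
  simp [forcing]

theorem forcing_add {N : ℕ} (hN : 0 < N) (u v : Fin N → ℝ) :
    forcing hN (u + v) = forcing hN u + forcing hN v := by
  ext t i
  fin_cases i <;> simp [forcing]

theorem forcing_smul {N : ℕ} (hN : 0 < N) (a : ℝ) (u : Fin N → ℝ) :
    forcing hN (a • u) = a • forcing hN u := by
  ext t i
  fin_cases i <;> simp [forcing]

theorem sum_forcing {N : ℕ} (hN : 0 < N) (u : Fin N → ℝ) :
    ∑ i ∈ Finset.range N, forcing hN u i = ![0, ∑ i, u i] := by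
  rw [Finset.sum_range]
  ext i
  fin_cases i <;> simp [forcing, Finset.sum_apply, Nat.mod_eq_of_lt]

theorem supNorm_forcing_le {N : ℕ} (hN : 0 < N) {u : Fin N → ℝ} {K : ℝ} (hu : ∀ i, |u i| ≤ K) :
    supNorm (forcing hN u) ≤ K :=
  ciSup_le fun t => by
    rw [forcing, euclNorm2_zero_left]
    exact hu _

end Forcing

/-- The solution operator of the linear periodic problem is linear and bounded by `C`. -/
theorem exists_linear_solution_operator {N : ℕ} (hN : 0 < N) {A : Matrix (Fin 2) (Fin 2) ℝ}
    {V : (Fin 2 → ℝ) →ₗ[ℝ] (Fin 2 → ℝ)} (hV : ∀ u : Fin 2 → ℝ, (1 - A ^ N) *ᵥ u = 0 → V u = u)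
    {P Q Mp : (ℕ → Fin 2 → ℝ) → (ℕ → Fin 2 → ℝ)}
    (hP : ∀ x : ℕ → Fin 2 → ℝ, P x = fun t => (A ^ t) *ᵥ V (x 0))
    (hQadd : ∀ h k, Q (h + k) = Q h + Q k) (hQsmul : ∀ (a : ℝ) h, Q (a • h) = a • Q h)
    (hMp : ∀ h : ℕ → Fin 2 → ℝ, (∀ t : ℕ, h (t + N) = h t) →
      (∃ x : ℕ → Fin 2 → ℝ, (∀ t : ℕ, x (t + N) = x t) ∧
        ∀ t : ℕ, x (t + 1) - A *ᵥ x t = h t) →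
      (∀ t : ℕ, Mp h (t + N) = Mp h t) ∧ P (Mp h) = 0 ∧
        ∀ t : ℕ, Mp h (t + 1) - A *ᵥ Mp h t = h t)
    {C : ℝ} (hC : ∀ h : ℕ → Fin 2 → ℝ, (∀ t : ℕ, h (t + N) = h t) →
      supNorm (Mp (h - Q h)) ≤ C * supNorm h)
    (hQper : ∀ h t, Q h (t + N) = Q h t)
    (hrange : ∀ h : ℕ → Fin 2 → ℝ, (∀ t : ℕ, h (t + N) = h t) →
      ∃ x : ℕ → Fin 2 → ℝ, (∀ t : ℕ, x (t + N) = x t) ∧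
        ∀ t : ℕ, x (t + 1) - A *ᵥ x t = (h - Q h) t) :
    ∃ T : (Fin N → ℝ) →ₗ[ℝ] (ℕ → Fin 2 → ℝ), ∀ u,
      (∀ t, T u (t + N) = T u t) ∧
      (∀ t, T u (t + 1) - A *ᵥ T u t = (forcing hN u - Q (forcing hN u)) t) ∧
      ∀ K, (∀ i, |u i| ≤ K) → ∀ t, |T u t 0| ≤ C * K := by
  let F : (Fin N → ℝ) → ℕ → Fin 2 → ℝ := fun u => Mp (forcing hN u - Q (forcing hN u))
  have hF : ∀ u, (∀ t, F u (t + N) = F u t) ∧ V (F u 0) = 0 ∧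
      ∀ t, F u (t + 1) - A *ᵥ F u t = (forcing hN u - Q (forcing hN u)) t := by
    intro u
    obtain ⟨h1, h2, h3⟩ := hMp (forcing hN u - Q (forcing hN u))
      (fun t => by simp only [Pi.sub_apply, forcing_periodic, hQper])
      (hrange _ (forcing_periodic hN u))
    refine ⟨h1, ?_, h3⟩
    simpa [hP] using congrFun h2 0
  have hC0 : 0 ≤ C := by
    have h1 := (supNorm_nonneg _).trans (hC (forcing hN 1) (forcing_periodic hN 1))
    have h2 : supNorm (forcing hN 1) = 1 := by
      simp [supNorm, forcing, euclNorm2_zero_left]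
    rwa [h2, mul_one] at h1
  have hadd : ∀ u v, F (u + v) = F u + F v := by
    intro u v
    rw [← sub_eq_zero]
    refine eq_zero_of_periodic_homogeneous_solution (N := N) (A := A) V hV ?_ ?_ ?_
    · intro t
      have h1 := (hF (u + v)).2.2 t
      have h2 := (hF u).2.2 t
      have h3 := (hF v).2.2 t
      rw [forcing_add, hQadd] at h1
      simp only [Pi.sub_apply, Pi.add_apply, mulVec_sub, mulVec_add] at h1 h2 h3 ⊢
      linear_combination (exp := 1) h1 - h2 - h3
    · intro t
      simp only [Pi.sub_apply, Pi.add_apply, (hF _).1]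
    · simp only [Pi.sub_apply, Pi.add_apply, map_sub, map_add, (hF _).2.1]
      simp
  have hsmul : ∀ (a : ℝ) u, F (a • u) = a • F u := by
    intro a u
    rw [← sub_eq_zero]
    refine eq_zero_of_periodic_homogeneous_solution (N := N) (A := A) V hV ?_ ?_ ?_
    · intro t
      have h1 := (hF (a • u)).2.2 t
      have h2 := congrArg (a • ·) ((hF u).2.2 t)
      rw [forcing_smul, hQsmul] at h1
      simp only [Pi.sub_apply, Pi.smul_apply, mulVec_sub, mulVec_smul, smul_sub] at h1 h2 ⊢
      linear_combination (exp := 1) h1 - h2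
    · intro t
      simp only [Pi.sub_apply, Pi.smul_apply, (hF _).1]
    · simp only [Pi.sub_apply, Pi.smul_apply, map_sub, map_smul, (hF _).2.1]
      simp
  refine ⟨⟨⟨F, hadd⟩, hsmul⟩, fun u => ⟨(hF u).1, (hF u).2.2, fun K hK t => ?_⟩⟩
  refine (abs_apply_zero_le_supNorm hN (hF u).1 t).trans
    ((hC _ (forcing_periodic hN u)).trans ?_)
  exact mul_le_mul_of_nonneg_left (supNorm_forcing_le hN hK) hC0

section Clamp

theorem abs_clamp_le {r : ℝ} (hr : 0 ≤ r) (x : ℝ) : |max (-r) (min r x)| ≤ r :=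
  abs_le.2 ⟨le_max_left _ _, max_le (by linarith) (min_le_left _ _)⟩

theorem clamp_of_abs_le {r x : ℝ} (hx : |x| ≤ r) : max (-r) (min r x) = x := by
  rw [min_eq_right (abs_le.1 hx).2, max_eq_right (abs_le.1 hx).1]

end Clamp

section NonlinearSystem

variable {ι : Type*} [Fintype ι] {z K : ℝ}

theorem exists_solution_of_bounded_operator {g : ι → ℝ → ℝ} (hg : ∀ i, Continuous (g i))
    (hz : 0 ≤ z) (hgK : ∀ i x, |x| ≤ z → |g i x| ≤ K) (T : (ι → ℝ) →ₗ[ℝ] (ι → ℝ))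
    (hT : ∀ u : ι → ℝ, (∀ i, |u i| ≤ K) → ∀ i, |T u i| ≤ z) :
    ∃ w : ι → ℝ, T (fun i => g i (w i)) = w := by
  let F : (ι → ℝ) → (ι → ℝ) := fun w => T fun i => g i (max (-z) (min z (w i)))
  have hF : Continuous F := T.continuous_of_finiteDimensional.comp (by fun_prop)
  have hb : ∀ w i, |F w i| ≤ z := fun w i => hT _ (fun j => hgK j _ (abs_clamp_le hz _)) i
  obtain ⟨w, hw⟩ := exists_fixedPoint_of_isBounded_range hF (by
    refine (Metric.isBounded_iff_subset_closedBall 0).2 ⟨z, ?_⟩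
    rintro _ ⟨w, rfl⟩
    exact mem_closedBall_zero_iff.2 ((pi_norm_le_iff_of_nonneg hz).2 (hb w)))
  refine ⟨w, ?_⟩
  have h : ∀ i, max (-z) (min z (w i)) = w i := fun i =>
    clamp_of_abs_le (by simpa [hw] using hb w i)
  have h' : F w = T fun i => g i (w i) := by simp only [F, h]
  rw [← h', hw]

theorem exists_solution_of_bounded_operator_of_sign {g : ι → ℝ → ℝ}
    (hg : ∀ i, Continuous (g i)) (hz : 0 < z) (hsign : ∀ i x, z < |x| → 0 < x * g i x)
    (hgK : ∀ i x, |x| ≤ 3 * z → |g i x| ≤ K) (T : (ι → ℝ) →ₗ[ℝ] (ι → ℝ))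
    (hT : ∀ u : ι → ℝ, (∀ i, |u i| ≤ K) → ∀ i, |T u i| < z) :
    ∃ (α : ℝ) (w : ι → ℝ), T (fun i => g i (α + w i)) = w ∧ ∑ i, g i (α + w i) = 0 := by
  let cl : ℝ → ℝ → ℝ := fun r x => max (-r) (min r x)
  let y : ℝ × (ι → ℝ) → ι → ℝ := fun p i => cl (2 * z) p.1 + cl z (p.2 i)
  have hy : ∀ p i, |y p i| ≤ 3 * z := fun p i =>
    (abs_add_le _ _).trans (by
      linarith [abs_clamp_le (by positivity : 0 ≤ 2 * z) p.1, abs_clamp_le hz.le (p.2 i)])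
  let F : ℝ × (ι → ℝ) → ℝ × (ι → ℝ) := fun p =>
    (cl (2 * z) p.1 - ∑ i, g i (y p i), T fun i => g i (y p i))
  have hF : Continuous F := by
    refine Continuous.prodMk (by fun_prop) (T.continuous_of_finiteDimensional.comp (by fun_prop))
  have hb : ∀ p i, |(F p).2 i| < z := fun p i => hT _ (fun j => hgK j _ (hy p j)) i
  have hb1 : ∀ p, |(F p).1| ≤ 2 * z + Fintype.card ι * K := fun p => by
    refine (abs_sub _ _).trans (add_le_add (abs_clamp_le (by positivity) _) ?_)
    refine (Finset.abs_sum_le_sum_abs _ _).trans ?_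
    refine (Finset.sum_le_sum fun i _ => hgK i _ (hy p i)).trans ?_
    simp
  obtain ⟨⟨α, w⟩, hp⟩ := exists_fixedPoint_of_isBounded_range hF (by
    refine (Metric.isBounded_iff_subset_closedBall 0).2
      ⟨max (2 * z + Fintype.card ι * K) z, ?_⟩
    rintro _ ⟨p, rfl⟩
    rw [mem_closedBall_zero_iff, Prod.norm_def]
    exact max_le_max (hb1 p) ((pi_norm_le_iff_of_nonneg hz.le).2 fun i => (hb p i).le))
  have hw' : ∀ i, |w i| < z := fun i => by simpa [hp] using hb (α, w) i
  have hw : ∀ i, cl z (w i) = w i := fun i => clamp_of_abs_le (hw' i).le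
  have h1 : cl (2 * z) α - ∑ i, g i (cl (2 * z) α + w i) = α := by
    simpa [F, y, hw] using congrArg Prod.fst hp
  have h2 : T (fun i => g i (cl (2 * z) α + w i)) = w := by
    simpa [F, y, hw] using congrArg Prod.snd hp
  have hα : |α| ≤ 2 * z := by
    rw [abs_le]
    constructor
    · by_contra! hlt
      have hcl : cl (2 * z) α = -(2 * z) := max_eq_left ((min_le_right _ _).trans hlt.le)
      rw [hcl] at h1
      have hneg : ∀ i, g i (-(2 * z) + w i) ≤ 0 := fun i => by
        have hx : -(2 * z) + w i < -z := by linarith [(abs_lt.1 (hw' i)).2]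
        have := hsign i _ (lt_abs.2 (Or.inr (by linarith : z < -(-(2 * z) + w i))))
        exact (neg_of_mul_pos_right this (by linarith)).le
      linarith [Finset.sum_nonpos fun i (_ : i ∈ Finset.univ) => hneg i]
    · by_contra! hlt
      have hcl : cl (2 * z) α = 2 * z := by
        simp only [cl, min_eq_left hlt.le]
        exact max_eq_right (by linarith)
      rw [hcl] at h1
      have hpos : ∀ i, 0 ≤ g i (2 * z + w i) := fun i => by
        have hx : z < 2 * z + w i := by linarith [(abs_lt.1 (hw' i)).1]
        have := hsign i _ (lt_abs.2 (Or.inl hx))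
        exact (pos_of_mul_pos_right this (by linarith)).le
      linarith [Finset.sum_nonneg fun i (_ : i ∈ Finset.univ) => hpos i]
  rw [show cl (2 * z) α = α from clamp_of_abs_le hα] at h1 h2
  exact ⟨α, w, h2, by linarith⟩

end NonlinearSystem

section Resonance

variable {b c : ℝ}

theorem exists_scalar_solution_of_system {N : ℕ} {f : ℕ → ℝ → ℝ} {x : ℕ → Fin 2 → ℝ}
    (hper : ∀ t, x (t + N) = x t)
    (hx : ∀ t, x (t + 1) - !![0, 1; -c, -b] *ᵥ x t = ![0, f t (x t 0)]) :
    ∃ y : ℕ → ℝ, (∀ t, y (t + N) = y t) ∧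
      ∀ t, y (t + 2) + b * y (t + 1) + c * y t = f t (y t) := by
  refine ⟨fun t => x t 0, fun t => by simp only [hper], fun t => ?_⟩
  have h0 : ∀ t, x (t + 1) 0 = x t 1 := fun t => by
    simpa [Matrix.mulVec, dotProduct, Fin.sum_univ_two, sub_eq_zero] using congrFun (hx t) 0
  have h1 := congrFun (hx t) 1
  simp [dotProduct, Fin.sum_univ_two] at h1
  change x (t + 1 + 1) 0 + b * x (t + 1) 0 + c * x t 0 = _
  rw [h0 (t + 1), h0 t]
  linarith

/-- For the companion matrix `A`, the equation `(1 - A) v = u` is solvable when `u` is orthogonal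
to `(-c, 1)`, which is a left eigenvector of `A` when `1 + b + c = 0`. -/
theorem exists_one_sub_companion_mulVec_eq {u : Fin 2 → ℝ}
    (hu : ![-c, 1] ⬝ᵥ u = 0) :
    ∃ v, (1 - !![0, 1; -c, -b]) *ᵥ v = u := by
  refine ⟨![u 0, 0], ?_⟩
  simp [dotProduct, Fin.sum_univ_two] at hu
  ext i
  fin_cases i
  · simp [Matrix.mulVec, dotProduct, Fin.sum_univ_two]
  · simp [Matrix.mulVec, dotProduct, Fin.sum_univ_two]
    linarith

theorem companion_left_eigenvector (h : 1 + b + c = 0) :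
    (!![0, 1; -c, -b] : Matrix (Fin 2) (Fin 2) ℝ)ᵀ *ᵥ ![-c, 1] = ![-c, 1] := by
  ext i
  fin_cases i <;> simp [Matrix.mulVec, dotProduct, Fin.sum_univ_two]
  linarith

theorem isUnit_one_sub_companion (h : 1 + b + c ≠ 0) :
    IsUnit (1 - !![0, 1; -c, -b] : Matrix (Fin 2) (Fin 2) ℝ) := by
  rw [Matrix.isUnit_iff_isUnit_det, Matrix.det_fin_two, isUnit_iff_ne_zero]
  simp
  intro h'
  exact h (by linarith)

variable {n m : Type*} [Fintype n] [DecidableEq n]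

theorem pow_transpose_mul_of_fixed {A : Matrix n n ℝ} {W : Matrix n m ℝ} (h : Aᵀ * W = W)
    (k : ℕ) : (A ^ k)ᵀ * W = W := by
  induction k with
  | zero => simp
  | succ k ih => rw [pow_succ, transpose_mul, Matrix.mul_assoc, ih, h]

theorem inv_transpose_mul_of_fixed {A : Matrix n n ℝ} {W : Matrix n m ℝ} (hA : IsUnit A.det)
    (h : Aᵀ * W = W) : (A⁻¹)ᵀ * W = W := by
  nth_rewrite 1 [← h]
  rw [← Matrix.mul_assoc, ← transpose_mul, Matrix.mul_nonsing_inv A hA, transpose_one,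
    Matrix.one_mul]

end Resonance

/-- Remark 3.2, rapid-growth example: Let `N > 1` be odd, `c ≠ 0`, `g`
continuous in `x` and `N`-periodic in `t`, and suppose there are `s ≥ 1`, `M₁, M₂ ≥ 0`
and `ẑ > 0` with: (i) `|g(t,x)| ≤ M₁|x|^s + M₂`; (ii) `x·g(t,x) > 0` for `|x| > ẑ`;
(iii) `ẑ + ‖M_p(I − Q)‖·(M₁·4^s·ẑ^s + M₂) < 2ẑ`; (iv) if `N·arccos(−b/2)` is an integer
multiple of `2π` then `c ≠ 1` or `|b| ≥ 2`.  Then there is an `N`-periodic solution.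
The operators `P`, `Q`, `M_p` and the operator-norm bound `C` are set up as in the
Lyapunov–Schmidt scheme. -/
theorem periodic_solution_rapid_growth
    (N : ℕ) (hN : 1 < N) (hNodd : Odd N) (b c : ℝ) (hc : c ≠ 0)
    (A : Matrix (Fin 2) (Fin 2) ℝ) (hA : A = !![0, 1; -c, -b])
    (g : ℕ → ℝ → ℝ) (hgcont : ∀ t : ℕ, Continuous (g t))
    (hgper : ∀ (t : ℕ) (x : ℝ), g (t + N) x = g t x)
    (s M₁ M₂ z : ℝ) (hs : 1 ≤ s) (hM₁ : 0 ≤ M₁) (hM₂ : 0 ≤ M₂) (hz : 0 < z)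
    -- (i)
    (hgrow : ∀ (t : ℕ) (x : ℝ), |g t x| ≤ M₁ * |x| ^ s + M₂)
    -- (ii)
    (hsign : ∀ (t : ℕ) (x : ℝ), z < |x| → 0 < x * g t x)
    -- (iv)
    (hres : (∃ k : ℤ, (N : ℝ) * Real.arccos (-b / 2) = 2 * Real.pi * k) →
      (c ≠ 1 ∨ 2 ≤ |b|))
    -- the orthogonal projection V onto Ker(I − A^N) and the projection P
    (V : (Fin 2 → ℝ) →ₗ[ℝ] (Fin 2 → ℝ))
    (hV1 : ∀ u : Fin 2 → ℝ, (1 - A ^ N) *ᵥ V u = 0)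
    (hV2 : ∀ u : Fin 2 → ℝ, (1 - A ^ N) *ᵥ u = 0 → V u = u)
    (hV3 : ∀ u w : Fin 2 → ℝ, (1 - A ^ N) *ᵥ w = 0 → (u - V u) ⬝ᵥ w = 0)
    (P : (ℕ → Fin 2 → ℝ) → (ℕ → Fin 2 → ℝ))
    (hP : ∀ x : ℕ → Fin 2 → ℝ, P x = fun t => (A ^ t) *ᵥ V (x 0))
    -- the projection Q built from a basis matrix W of Ker((I − A^N)ᵀ)
    (m : ℕ) (W : Matrix (Fin 2) (Fin m) ℝ)
    (hWli : LinearIndependent ℝ (fun j : Fin m => Wᵀ j))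
    (hWspan : Submodule.span ℝ (Set.range fun j : Fin m => Wᵀ j) =
      LinearMap.ker (((1 - A ^ N)ᵀ).mulVecLin))
    (Ψ : ℕ → Matrix (Fin 2) (Fin m) ℝ)
    (hΨ : ∀ t : ℕ, Ψ t = ((A⁻¹) ^ t)ᵀ * (A ^ N)ᵀ * W)
    (G : Matrix (Fin m) (Fin m) ℝ)
    (hG : G = ∑ j ∈ Finset.range N, (Ψ j)ᵀ * Ψ j)
    (Q : (ℕ → Fin 2 → ℝ) → (ℕ → Fin 2 → ℝ))
    (hQ : ∀ h : ℕ → Fin 2 → ℝ,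
      Q h = fun t => Ψ t *ᵥ (G⁻¹ *ᵥ ∑ i ∈ Finset.range N, (Ψ i)ᵀ *ᵥ h i))
    -- M_p : range 𝓛 → Ker P, the inverse of the restriction of 𝓛
    (Mp : (ℕ → Fin 2 → ℝ) → (ℕ → Fin 2 → ℝ))
    (hMp : ∀ h : ℕ → Fin 2 → ℝ, (∀ t : ℕ, h (t + N) = h t) →
      (∃ x : ℕ → Fin 2 → ℝ, (∀ t : ℕ, x (t + N) = x t) ∧
        ∀ t : ℕ, x (t + 1) - A *ᵥ x t = h t) →
      (∀ t : ℕ, Mp h (t + N) = Mp h t) ∧ P (Mp h) = 0 ∧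
        ∀ t : ℕ, Mp h (t + 1) - A *ᵥ Mp h t = h t)
    -- C is a bound for the operator norm ‖M_p ∘ (I − Q)‖ on X_N
    (C : ℝ)
    (hC : ∀ h : ℕ → Fin 2 → ℝ, (∀ t : ℕ, h (t + N) = h t) →
      supNorm (Mp (h - Q h)) ≤ C * supNorm h)
    -- (iii)
    (hC3 : z + C * (M₁ * 4 ^ s * z ^ s + M₂) < 2 * z) :
    ∃ y : ℕ → ℝ, (∀ t : ℕ, y (t + N) = y t) ∧
      ∀ t : ℕ, y (t + 2) + b * y (t + 1) + c * y t = g t (y t) := by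
  have hN0 : 0 < N := by omega
  have hAdet : IsUnit A.det := by
    rw [hA, Matrix.det_fin_two, isUnit_iff_ne_zero]
    simpa using hc
  have hS : IsUnit (∑ i ∈ Finset.range N, A ^ i) := by
    rw [hA]
    exact isUnit_geom_sum_companion hNodd hres
  have hfac : (1 - A) * ∑ i ∈ Finset.range N, A ^ i = 1 - A ^ N := mul_neg_geom_sum A N
  have hWker : (1 - A)ᵀ * W = 0 := by
    have h1 : (1 - A ^ N)ᵀ * W = 0 := by
      ext i j
      have h : Wᵀ j ∈ LinearMap.ker (((1 - A ^ N)ᵀ).mulVecLin) :=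
        hWspan ▸ Submodule.subset_span ⟨j, rfl⟩
      exact congrFun (LinearMap.mem_ker.1 h) i
    rw [← hfac, transpose_mul, Matrix.mul_assoc] at h1
    obtain ⟨S', hS'⟩ := hS.exists_right_inv
    have hST : S'ᵀ * (∑ i ∈ Finset.range N, A ^ i)ᵀ = 1 := by
      rw [← transpose_mul, hS', transpose_one]
    calc (1 - A)ᵀ * W = S'ᵀ * (∑ i ∈ Finset.range N, A ^ i)ᵀ * ((1 - A)ᵀ * W) := by
          rw [hST, Matrix.one_mul]
      _ = 0 := by rw [Matrix.mul_assoc, h1, Matrix.mul_zero]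
  have hAW : Aᵀ * W = W := by
    rw [transpose_sub, transpose_one, Matrix.sub_mul, Matrix.one_mul, sub_eq_zero] at hWker
    exact hWker.symm
  have hΨW : ∀ t, Ψ t = W := fun t => by
    rw [hΨ, Matrix.mul_assoc, pow_transpose_mul_of_fixed hAW,
      pow_transpose_mul_of_fixed (inv_transpose_mul_of_fixed hAdet hAW)]
  have hQ' : ∀ h, Q h = fun _ => W *ᵥ (G⁻¹ *ᵥ (Wᵀ *ᵥ ∑ i ∈ Finset.range N, h i)) := fun h => by
    rw [hQ]
    simp only [hΨW, Matrix.mulVec_sum]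
  have hG' : G = (N : ℝ) • (Wᵀ * W) := by
    rw [hG]
    simp only [hΨW, Finset.sum_const, Finset.card_range]
    exact (Nat.cast_smul_eq_nsmul ℝ N _).symm
  have hQadd : ∀ h k, Q (h + k) = Q h + Q k := fun h k => by
    simp only [hQ', Pi.add_apply, Finset.sum_add_distrib, mulVec_add]
    rfl
  have hQsmul : ∀ (a : ℝ) h, Q (a • h) = a • Q h := fun a h => by
    simp only [hQ', Pi.smul_apply, ← Finset.smul_sum, mulVec_smul]
    rfl
  have hQper : ∀ h t, Q h (t + N) = Q h t := fun h t => by simp only [hQ']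
  have hQzero : ∀ h, ∑ i ∈ Finset.range N, h i = 0 → Q h = 0 := fun h h0 => by
    rw [hQ', h0]
    simp only [mulVec_zero]
    rfl
  have hrange : ∀ h : ℕ → Fin 2 → ℝ, (∀ t : ℕ, h (t + N) = h t) →
      ∃ x : ℕ → Fin 2 → ℝ, (∀ t : ℕ, x (t + N) = x t) ∧
        ∀ t : ℕ, x (t + 1) - A *ᵥ x t = (h - Q h) t := by
    intro h hh
    refine exists_periodic_linear_solution A
      (fun t => by simp only [Pi.sub_apply, hh, hQper]) fun x hx0 hx => ?_
    suffices ∃ v, (1 - A) *ᵥ v = x N by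
      obtain ⟨v, hv⟩ := this
      obtain ⟨S', hS'⟩ := hS.exists_right_inv
      refine ⟨S' *ᵥ v, ?_⟩
      rw [mulVec_mulVec, ← hfac, Matrix.mul_assoc, hS', Matrix.mul_one, hv]
    by_cases hbc : 1 + b + c = 0
    · rw [hA]
      refine exists_one_sub_companion_mulVec_eq ?_
      have hl : Aᵀ *ᵥ ![-c, 1] = ![-c, 1] := hA ▸ companion_left_eigenvector hbc
      have hl' : ∀ u, ![-c, 1] ⬝ᵥ (A *ᵥ u) = ![-c, 1] ⬝ᵥ u := fun u => by
        rw [dotProduct_mulVec, ← mulVec_transpose, hl]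
      have hsum : ∀ t, ![-c, 1] ⬝ᵥ x t =
          ![-c, 1] ⬝ᵥ ∑ i ∈ Finset.range t, (h - Q h) i := by
        intro t
        induction t with
        | zero => simp [hx0]
        | succ t ih => rw [hx, Finset.sum_range_succ, dotProduct_add, dotProduct_add, hl', ih]
      have hmem : ![-c, 1] ∈ LinearMap.ker (((1 - A ^ N)ᵀ).mulVecLin) := by
        have : (1 - A)ᵀ *ᵥ ![-c, 1] = 0 := by
          rw [transpose_sub, transpose_one, sub_mulVec, one_mulVec, hl, sub_self]
        rw [LinearMap.mem_ker, mulVecLin_apply, ← hfac, transpose_mul, ← mulVec_mulVec, this,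
          mulVec_zero]
      rw [← hWspan] at hmem
      obtain ⟨v, hv⟩ : ![-c, 1] ∈ LinearMap.range W.mulVecLin := by
        rw [Matrix.range_mulVecLin]
        exact hmem
      have horth : Wᵀ *ᵥ ∑ i ∈ Finset.range N, (h - Q h) i = 0 := by
        simp only [Pi.sub_apply, Finset.sum_sub_distrib, hQ', Finset.sum_const, Finset.card_range]
        rw [mulVec_sub, ← Nat.cast_smul_eq_nsmul ℝ, mulVec_smul,
          transpose_mulVec_gram_inv hN0 hWli hG', sub_self]
      rw [hsum, ← hv, mulVecLin_apply, dotProduct_comm, dotProduct_mulVec, ← mulVec_transpose,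
        horth, zero_dotProduct]
    · obtain ⟨B, hB⟩ := (hA ▸ isUnit_one_sub_companion hbc : IsUnit (1 - A)).exists_right_inv
      exact ⟨B *ᵥ x N, by rw [mulVec_mulVec, hB, one_mulVec]⟩
  obtain ⟨T, hT⟩ := exists_linear_solution_operator hN0 hV2 hP hQadd hQsmul hMp hC hQper hrange
  set K := M₁ * 4 ^ s * z ^ s + M₂ with hK
  have hgK : ∀ t x, |x| ≤ 3 * z → |g t x| ≤ K := fun t x hx => by
    refine (hgrow t x).trans ?_
    rw [hK, mul_assoc, ← Real.mul_rpow (by norm_num) hz.le]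
    gcongr
    linarith
  let R : (ℕ → Fin 2 → ℝ) →ₗ[ℝ] (Fin N → ℝ) :=
    { toFun := fun x i => x i 0
      map_add' := fun _ _ => rfl
      map_smul' := fun _ _ => rfl }
  have hRT : ∀ u : Fin N → ℝ, (∀ i, |u i| ≤ K) → ∀ i, |(R ∘ₗ T) u i| < z := fun u hu i =>
    ((hT u).2.2 K hu i).trans_lt (by linarith)
  have hg_mod : ∀ t x, g (t % N) x = g t x := fun t x =>
    Function.Periodic.map_mod_nat (f := fun t => g t x) (fun t => hgper t x) t
  have hT_mod : ∀ u t, T u (t % N) = T u t := fun u t =>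
    Function.Periodic.map_mod_nat (hT u).1 t
  by_cases hbc : 1 + b + c = 0
  · obtain ⟨α, w, hw, hsum⟩ := exists_solution_of_bounded_operator_of_sign
      (g := fun i : Fin N => g i) (fun i => hgcont i) hz (fun i => hsign i) (fun i => hgK i)
      (R ∘ₗ T) hRT
    set u : Fin N → ℝ := fun i => g i (α + w i) with hu
    have hQ0 : Q (forcing hN0 u) = 0 := hQzero _ (by
      rw [sum_forcing, hsum]
      ext i
      fin_cases i <;> rfl)
    have hconst : A *ᵥ (fun _ => α) = fun _ => α := by
      rw [hA]
      ext i
      fin_cases i <;> simp [Matrix.mulVec, dotProduct, Fin.sum_univ_two]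
      linear_combination (-α) * hbc
    refine exists_scalar_solution_of_system (x := fun t => (fun _ => α) + T u t)
      (fun t => by simp only [(hT u).1]) fun t => ?_
    have h := (hT u).2.1 t
    rw [hQ0, sub_zero] at h
    rw [← hA, mulVec_add, hconst, add_sub_add_left_eq_sub, h]
    simp only [forcing, hu, hg_mod, Pi.add_apply]
    rw [← hT_mod u t]
    congr 4
    exact (congrFun hw ⟨t % N, Nat.mod_lt t hN0⟩).symm
  · obtain ⟨w, hw⟩ := exists_solution_of_bounded_operator
      (g := fun i : Fin N => g i) (fun i => hgcont i) hz.le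
      (fun i x hx => hgK i x (by linarith)) (R ∘ₗ T) fun u hu i => (hRT u hu i).le
    set u : Fin N → ℝ := fun i => g i (w i) with hu
    have hW0 : W = 0 := by
      obtain ⟨B, hB⟩ := (hA ▸ isUnit_one_sub_companion hbc : IsUnit (1 - A)).exists_right_inv
      have h2 := congrArg (Bᵀ * ·) hWker
      simpa only [← Matrix.mul_assoc, ← transpose_mul, hB, transpose_one, Matrix.one_mul,
        Matrix.mul_zero] using h2
    have hQ0 : Q (forcing hN0 u) = 0 := by
      rw [hQ', hW0]
      simp only [zero_mulVec]
      rfl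
    refine exists_scalar_solution_of_system (x := T u) (hT u).1 fun t => ?_
    have h := (hT u).2.1 t
    rw [hQ0, sub_zero] at h
    rw [← hA, h]
    simp only [forcing, hu, hg_mod]
    rw [← hT_mod u t]
    congr 3
    exact (congrFun hw ⟨t % N, Nat.mod_lt t hN0⟩).symm
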